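/- Let R^8 be the profile ≽_1: {a,c},{b,d}; ≽_2: {b,d},{a,c}; ≽_3: a,d,{b,c}; ≽_4: {b,c},a,d. Then f(R^8) = 1/2 a + 1/2 b. -/

import Mathlib

open Finset
open scoped Classical

section Framework

variable {A : Type*} [Fintype A] {n : ℕ}

/-- `p` is a lottery (probability distribution) on the set of alternatives `A`. -/
def IsLottery (p : A → ℝ) : Prop := (∀ x, 0 ≤ p x) ∧ ∑ x, p x = 1

/-- `r` is a weak preference relation: complete (total) and transitive. -/
def IsPref (r : A → A → Prop) : Prop := Total r ∧ Transitive r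

/-- A preference profile assigns a weak preference relation to each of the `n` agents. -/
def IsProfile (R : Fin n → A → A → Prop) : Prop := ∀ i, IsPref (R i)

/-- The probability that `p` assigns to alternatives weakly preferred (by `r`) to `x`. -/
noncomputable def upperProb (r : A → A → Prop) (p : A → ℝ) (x : A) : ℝ :=
  ∑ y ∈ univ.filter (fun y => r y x), p y

/-- Stochastic dominance: `p ≽^sd q` w.r.t. the preference relation `r`. -/
def SDge (r : A → A → Prop) (p q : A → ℝ) : Prop :=
  ∀ x, upperProb r q x ≤ upperProb r p x

/-- Strict stochastic dominance: `p ≻^sd q` w.r.t. the preference relation `r`. -/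
def SDgt (r : A → A → Prop) (p q : A → ℝ) : Prop :=
  SDge r p q ∧ ¬ SDge r q p

/-- A social decision scheme maps every preference profile to a lottery. -/
def IsSDS (f : (Fin n → A → A → Prop) → (A → ℝ)) : Prop :=
  ∀ R : Fin n → A → A → Prop, IsProfile R → IsLottery (f R)

/-- Anonymity: invariance under permutations of the agents. -/
def Anonymous (f : (Fin n → A → A → Prop) → (A → ℝ)) : Prop :=
  ∀ R : Fin n → A → A → Prop, IsProfile R → ∀ π : Equiv.Perm (Fin n),
    f (fun i => R (π i)) = f R

/-- Neutrality: `f(R^σ)(σ x) = f(R)(x)`, where `R^σ` relabels alternatives by `σ`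
(i.e. `σ x ≽^σ_i σ y ↔ x ≽_i y`). -/
def Neutral (f : (Fin n → A → A → Prop) → (A → ℝ)) : Prop :=
  ∀ R : Fin n → A → A → Prop, IsProfile R → ∀ σ : Equiv.Perm A, ∀ x : A,
    f (fun i u v => R i (σ.symm u) (σ.symm v)) (σ x) = f R x

/-- The lottery `p` is sd-efficient for the profile `R`: no lottery `q` is weakly
sd-preferred to `p` by all agents and strictly sd-preferred by some agent. -/
def SDEfficientLottery (R : Fin n → A → A → Prop) (p : A → ℝ) : Prop :=
  ¬ ∃ q : A → ℝ, IsLottery q ∧ (∀ i, SDge (R i) q p) ∧ (∃ i, SDgt (R i) q p)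

/-- sd-efficiency of a social decision scheme. -/
def SDEfficient (f : (Fin n → A → A → Prop) → (A → ℝ)) : Prop :=
  ∀ R : Fin n → A → A → Prop, IsProfile R → SDEfficientLottery R (f R)

/-- sd-strategyproofness: no agent can misreport and obtain a strictly
sd-preferred lottery. -/
def SDStrategyproof (f : (Fin n → A → A → Prop) → (A → ℝ)) : Prop :=
  ∀ R R' : Fin n → A → A → Prop, IsProfile R → IsProfile R' → ∀ i : Fin n,
    (∀ j, j ≠ i → R j = R' j) → ¬ SDgt (R i) (f R') (f R)

/-- `x` is the unique most-preferred alternative of the relation `r`. -/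
def UniqueTop (r : A → A → Prop) (x : A) : Prop :=
  ∀ y, y ≠ x → r x y ∧ ¬ r y x

/-- `f` extends random dictatorship: whenever every agent has a unique top choice,
each alternative gets probability (number of agents having it as top)/n. -/
def ExtendsRD (f : (Fin n → A → A → Prop) → (A → ℝ)) : Prop :=
  ∀ R : Fin n → A → A → Prop, IsProfile R →
    ∀ t : Fin n → A, (∀ i, UniqueTop (R i) (t i)) →
      ∀ x : A, f R x = ((univ.filter (fun i => t i = x)).card : ℝ) / (n : ℝ)

/-- `x` is Pareto-dominated in the profile `R`. -/
def Pareto_Dominated (R : Fin n → A → A → Prop) (x : A) : Prop :=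
  ∃ y : A, (∀ i, R i y x) ∧ ∃ i, R i y x ∧ ¬ R i x y

end Framework

/-! Concrete setting: alternatives `A = {a,b,c,d}` encoded as `Fin 4`. -/

/-- The alternative `a`. -/ def a : Fin 4 := 0
/-- The alternative `b`. -/ def b : Fin 4 := 1
/-- The alternative `c`. -/ def c : Fin 4 := 2
/-- The alternative `d`. -/ def d : Fin 4 := 3

/-- The weak preference relation induced by a rank function over `(a,b,c,d)`
(lower rank = more preferred; equal ranks = indifference). -/
def pr (rk : Fin 4 → ℕ) : Fin 4 → Fin 4 → Prop := fun x y => rk x ≤ rk y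


/-- The profile `R8`: ≽₁: {a,c},{b,d}; ≽₂: {b,d},{a,c}; ≽₃: a,d,{b,c}; ≽₄: {b,c},a,d. -/
def R8 : Fin 4 → Fin 4 → Fin 4 → Prop :=
  ![pr ![0,1,0,1], pr ![1,0,1,0], pr ![0,2,2,1], pr ![1,0,0,2]]

/-! The four axioms are jointly inconsistent: eight profiles suffice for a contradiction, and
the value of `f` at `R8` follows. -/

section Framework

variable {A : Type*} [Fintype A] {n : ℕ}

lemma upperProb_add (r : A → A → Prop) (p q : A → ℝ) (x : A) :
    upperProb r (p + q) x = upperProb r p x + upperProb r q x :=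
  Finset.sum_add_distrib

/-- At an sd-efficient lottery there is no feasible direction that improves all agents. -/
lemma SDEfficientLottery.not_improvable {R : Fin n → A → A → Prop} {p : A → ℝ}
    (hp : SDEfficientLottery R p) (hl : IsLottery p) (δ : A → ℝ) (hsum : ∑ x, δ x = 0)
    (hpos : ∀ x, 0 ≤ p x + δ x) (hge : ∀ i x, 0 ≤ upperProb (R i) δ x)
    (i : Fin n) (x : A) (hgt : 0 < upperProb (R i) δ x) : False := by
  have hsd : ∀ j, SDge (R j) (p + δ) p := fun j y => by
    rw [upperProb_add]
    linarith [hge j y]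
  refine hp ⟨p + δ, ⟨hpos, ?_⟩, hsd, i, hsd i, fun h => ?_⟩
  · simp [Finset.sum_add_distrib, hl.2, hsum]
  · have := h x
    rw [upperProb_add] at this
    linarith

end Framework

/-- The profile over `{a,b,c,d}` in which agent `i` has the preferences induced by `rk i`. -/
def rankProfile (rk : Fin 4 → Fin 4 → ℕ) : Fin 4 → Fin 4 → Fin 4 → Prop := fun i => pr (rk i)

lemma isProfile_rankProfile (rk : Fin 4 → Fin 4 → ℕ) : IsProfile (rankProfile rk) := fun i =>
  ⟨fun x y => le_total (rk i x) (rk i y), fun _ _ _ h₁ h₂ => le_trans (α := ℕ) h₁ h₂⟩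

lemma upperProb_pr (rk : Fin 4 → ℕ) (p : Fin 4 → ℝ) (x : Fin 4) :
    upperProb (pr rk) p x = ∑ y, if rk y ≤ rk x then p y else 0 := by
  rw [upperProb, Finset.sum_filter]
  exact Finset.sum_congr rfl fun y _ => if_congr Iff.rfl rfl rfl

section Axioms

variable {f : (Fin 4 → Fin 4 → Fin 4 → Prop) → (Fin 4 → ℝ)}

/-- Simultaneously relabelling agents by `π` and alternatives by `σ` relabels the lottery. -/
lemma apply_relabel (han : Anonymous f) (hneu : Neutral f) {rk rk' : Fin 4 → Fin 4 → ℕ}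
    (π σ : Equiv.Perm (Fin 4)) (h : ∀ i x, rk' i (σ x) = rk (π i) x) (x : Fin 4) :
    f (rankProfile rk') (σ x) = f (rankProfile rk) x := by
  rw [← han _ (isProfile_rankProfile rk) π]
  refine Eq.trans ?_ (hneu _ (isProfile_rankProfile fun i => rk (π i)) σ x)
  congr 1
  funext i u v
  simp [rankProfile, pr, ← h]

lemma eq_zero_of_dominated (hf : IsSDS f) (heff : SDEfficient f) (rk : Fin 4 → Fin 4 → ℕ)
    (x y : Fin 4) (h : ∀ i, rk i y ≤ rk i x) (i : Fin 4) (hi : rk i y < rk i x) :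
    f (rankProfile rk) x = 0 := by
  have hl := hf _ (isProfile_rankProfile rk)
  set p := f (rankProfile rk) with hp
  by_contra hne
  have hx : 0 < p x := lt_of_le_of_ne (hl.1 x) (Ne.symm hne)
  have hxy : x ≠ y := fun e => by simp [e] at hi
  have hup : ∀ j z, upperProb (pr (rk j)) (Pi.single y (p x) - Pi.single x (p x)) z =
      (if rk j y ≤ rk j z then p x else 0) - if rk j x ≤ rk j z then p x else 0 := by
    intro j z
    simp [upperProb_pr, Pi.single_apply, Finset.sum_ite, Finset.sum_sub_distrib]
  refine (heff _ (isProfile_rankProfile rk)).not_improvable hl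
    (Pi.single y (p x) - Pi.single x (p x)) (by simp) (fun z => ?_) (fun j z => ?_) i y ?_
  · have hz := hl.1 z
    rcases eq_or_ne z x with rfl | hzx
    · simp [← hp, hxy]
    · have : 0 ≤ (Pi.single y (p x) : Fin 4 → ℝ) z := by
        rw [Pi.single_apply]; split_ifs <;> simp [hx.le]
      simp only [Pi.sub_apply, Pi.single_eq_of_ne hzx]
      linarith
  · change 0 ≤ upperProb (pr (rk j)) _ z
    rw [hup]
    have := h j
    split_ifs <;> linarith
  · change 0 < upperProb (pr (rk i)) _ y
    rw [hup, if_pos le_rfl, if_neg (by omega)]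
    simpa using hx

/-- If agent `i`, whose preferences are induced by `r`, weakly gains by a misreport, then she also
weakly loses by it. -/
lemma SDStrategyproof.reverse (hsp : SDStrategyproof f) (rk rk' : Fin 4 → Fin 4 → ℕ) (i : Fin 4)
    (r : Fin 4 → ℕ) (hr : rk i = r) (hne : ∀ j, j ≠ i → rk j = rk' j)
    (hge : ∀ x, (∑ y, if r y ≤ r x then f (rankProfile rk) y else 0) ≤
      ∑ y, if r y ≤ r x then f (rankProfile rk') y else 0) (x : Fin 4) :
    (∑ y, if r y ≤ r x then f (rankProfile rk') y else 0) ≤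
      ∑ y, if r y ≤ r x then f (rankProfile rk) y else 0 := by
  subst hr
  have h := hsp _ _ (isProfile_rankProfile rk) (isProfile_rankProfile rk') i
    fun j hj => congrArg pr (hne j hj)
  have hge' : SDge (rankProfile rk i) (f (rankProfile rk')) (f (rankProfile rk)) := fun z => by
    simpa only [rankProfile, upperProb_pr] using hge z
  have := not_not.1 (fun hn => h ⟨hge', hn⟩) x
  simpa only [rankProfile, upperProb_pr] using this

/-- The lottery chosen at a rank profile, coordinate by coordinate. -/
lemma lottery_rankProfile (hf : IsSDS f) (rk : Fin 4 → Fin 4 → ℕ) :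
    0 ≤ f (rankProfile rk) 0 ∧ 0 ≤ f (rankProfile rk) 1 ∧ 0 ≤ f (rankProfile rk) 2 ∧
      0 ≤ f (rankProfile rk) 3 ∧ f (rankProfile rk) 0 + f (rankProfile rk) 1 +
        f (rankProfile rk) 2 + f (rankProfile rk) 3 = 1 := by
  have h := hf _ (isProfile_rankProfile rk)
  exact ⟨h.1 0, h.1 1, h.1 2, h.1 3, by rw [← Fin.sum_univ_four]; exact h.2⟩

/-- The profile `{c,d},{a,b}; {c,d},b,a; b,d,{a,c}; {a,b},{c,d}`. -/
def P1 : Fin 4 → Fin 4 → ℕ := ![![1,1,0,0], ![2,1,0,0], ![2,0,2,1], ![0,0,1,1]]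

/-- The profile `{c,d},{a,b}; d,b,{a,c}; b,d,{a,c}; {a,b},{c,d}`. -/
def P2 : Fin 4 → Fin 4 → ℕ := ![![1,1,0,0], ![2,1,2,0], ![2,0,2,1], ![0,0,1,1]]

/-- The profile `{a,d},{b,c}; {c,d},b,a; {b,d},c,a; {b,c},{a,d}`. -/
def P3 : Fin 4 → Fin 4 → ℕ := ![![0,1,1,0], ![2,1,0,0], ![2,0,1,0], ![1,0,0,1]]

/-- The profile `{a,d},{b,c}; {a,c},d,b; {b,d},c,a; {b,c},{a,d}`. -/
def P4 : Fin 4 → Fin 4 → ℕ := ![![0,1,1,0], ![0,2,0,1], ![2,0,1,0], ![1,0,0,1]]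

/-- The profile `{c,d},{a,b}; {c,d},b,a; {b,d},c,a; b,c,{a,d}`. -/
def P5 : Fin 4 → Fin 4 → ℕ := ![![1,1,0,0], ![2,1,0,0], ![2,0,1,0], ![2,0,1,2]]

/-- The profile `{c,d},{a,b}; {c,d},b,a; b,d,{a,c}; b,c,{a,d}`. -/
def P6 : Fin 4 → Fin 4 → ℕ := ![![1,1,0,0], ![2,1,0,0], ![2,0,2,1], ![2,0,1,2]]

/-- The profile `{a,d},{b,c}; {c,d},b,a; {b,d},c,a; b,c,{a,d}`. -/
def P7 : Fin 4 → Fin 4 → ℕ := ![![0,1,1,0], ![2,1,0,0], ![2,0,1,0], ![2,0,1,2]]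

/-- The profile `{c,d},{a,b}; {c,d},b,a; {b,d},c,a; {b,c},d,a`. -/
def P8 : Fin 4 → Fin 4 → ℕ := ![![1,1,0,0], ![2,1,0,0], ![2,0,1,0], ![2,0,0,1]]

lemma apply_P4 (hf : IsSDS f) (han : Anonymous f) (hneu : Neutral f) (heff : SDEfficient f) :
    f (rankProfile P4) 0 = 0 ∧ f (rankProfile P4) 1 = 0 ∧
      f (rankProfile P4) 2 = 1/2 ∧ f (rankProfile P4) 3 = 1/2 := by
  obtain ⟨h0, h1, h2, h3, hs⟩ := lottery_rankProfile hf P4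
  have hsymm := apply_relabel han hneu (rk := P4) (rk' := P4)
    (Equiv.swap 0 3 * Equiv.swap 1 2) (Equiv.swap 0 1 * Equiv.swap 2 3) (by decide)
  have h01 : f (rankProfile P4) 1 = f (rankProfile P4) 0 := hsymm 0
  have h23 : f (rankProfile P4) 3 = f (rankProfile P4) 2 := hsymm 2
  have ha : f (rankProfile P4) 0 = 0 := by
    by_contra hne
    have hpos : 0 < f (rankProfile P4) 0 := lt_of_le_of_ne h0 (Ne.symm hne)
    set t := f (rankProfile P4) 0 with ht
    refine (heff _ (isProfile_rankProfile P4)).not_improvable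
      (hf _ (isProfile_rankProfile P4)) ![-t, -t, t, t] ?_ ?_ ?_ 1 3 ?_
    · simp [Fin.sum_univ_four]
    · simp [Fin.forall_fin_succ, ← ht, h01, h23]
      linarith
    · simp [Fin.forall_fin_succ, rankProfile, upperProb_pr, Fin.sum_univ_four, P4, hpos.le]
    · simpa [rankProfile, upperProb_pr, Fin.sum_univ_four, P4] using hpos
  refine ⟨ha, ?_, ?_, ?_⟩ <;> linarith

lemma apply_P3 (hf : IsSDS f) (han : Anonymous f) (hneu : Neutral f)
    (heff : SDEfficient f) (hsp : SDStrategyproof f) :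
    f (rankProfile P3) 3 = 1 := by
  obtain ⟨-, h1, h2, h3, hs⟩ := lottery_rankProfile hf P3
  obtain ⟨a4, b4, c4, d4⟩ := apply_P4 hf han hneu heff
  have ha := eq_zero_of_dominated hf heff P3 0 3 (by decide) 1 (by decide)
  have hbc : f (rankProfile P3) 2 = f (rankProfile P3) 1 := apply_relabel han hneu
    (rk := P3) (rk' := P3) (Equiv.swap 1 2) (Equiv.swap 1 2) (by decide) 1
  have h := hsp.reverse P3 P4 1 ![2,1,0,0] rfl (by decide)
  simp [Fin.forall_fin_succ, Fin.sum_univ_four, ha, hbc, a4, b4, c4, d4] at h hs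
  obtain ⟨-, h'⟩ := h (by linarith) (by linarith)
  linarith

lemma apply_P7 (hf : IsSDS f) (han : Anonymous f) (hneu : Neutral f)
    (heff : SDEfficient f) (hsp : SDStrategyproof f) :
    f (rankProfile P7) 3 = 1 := by
  obtain ⟨-, p1, p2, p3, ps⟩ := lottery_rankProfile hf P3
  obtain ⟨-, h1, h2, h3, hs⟩ := lottery_rankProfile hf P7
  have d3 := apply_P3 hf han hneu heff hsp
  have a3 := eq_zero_of_dominated hf heff P3 0 3 (by decide) 1 (by decide)
  have a7 := eq_zero_of_dominated hf heff P7 0 3 (by decide) 1 (by decide)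
  have b3 : f (rankProfile P3) 1 = 0 := by linarith
  have c3 : f (rankProfile P3) 2 = 0 := by linarith
  have h := hsp.reverse P3 P7 3 ![1,0,0,1] rfl (by decide)
  simp [Fin.forall_fin_succ, Fin.sum_univ_four, a3, b3, c3, d3, a7] at h hs
  obtain ⟨-, h', -⟩ := h (by linarith) (by linarith) (by linarith)
  linarith

lemma apply_P5 (hf : IsSDS f) (han : Anonymous f) (hneu : Neutral f)
    (heff : SDEfficient f) (hsp : SDStrategyproof f) :
    f (rankProfile P5) 0 = 0 ∧ f (rankProfile P5) 1 = 0 ∧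
      f (rankProfile P5) 2 = 1/2 ∧ f (rankProfile P5) 3 = 1/2 := by
  obtain ⟨-, p1, p2, p3, ps⟩ := lottery_rankProfile hf P7
  obtain ⟨-, q1, q2, q3, qs⟩ := lottery_rankProfile hf P8
  obtain ⟨-, h1, h2, h3, hs⟩ := lottery_rankProfile hf P5
  have d7 := apply_P7 hf han hneu heff hsp
  have a7 := eq_zero_of_dominated hf heff P7 0 3 (by decide) 1 (by decide)
  have a8 := eq_zero_of_dominated hf heff P8 0 1 (by decide) 1 (by decide)
  have a5 := eq_zero_of_dominated hf heff P5 0 1 (by decide) 1 (by decide)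
  have b7 : f (rankProfile P7) 1 = 0 := by linarith
  have c7 : f (rankProfile P7) 2 = 0 := by linarith
  have hcd : f (rankProfile P8) 3 = f (rankProfile P8) 2 := apply_relabel han hneu
    (rk := P8) (rk' := P8) (Equiv.swap 2 3) (Equiv.swap 2 3) (by decide) 2
  have h57 := hsp.reverse P5 P7 0 ![1,1,0,0] rfl (by decide)
  have h58 := hsp.reverse P5 P8 3 ![2,0,1,2] rfl (by decide)
  have h85 := hsp.reverse P8 P5 3 ![2,0,0,1] rfl (by decide)
  simp [Fin.forall_fin_succ, Fin.sum_univ_four, a7, b7, c7, d7, a8, a5, hcd] at h57 h58 h85 hs qs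
  obtain ⟨-, hcd5⟩ := h57 (by linarith) (by linarith)
  have hle : f (rankProfile P5) 1 + f (rankProfile P5) 2 ≤
      f (rankProfile P8) 1 + f (rankProfile P8) 2 := by
    by_contra! hlt
    obtain ⟨-, h', -⟩ := h85 (by linarith) hlt.le (by linarith)
    linarith
  obtain ⟨-, hb, hbc, -⟩ := h58 (by linarith) (by linarith) hle (by linarith)
  refine ⟨a5, ?_, ?_, ?_⟩ <;> linarith

lemma apply_P6 (hf : IsSDS f) (han : Anonymous f) (hneu : Neutral f)
    (heff : SDEfficient f) (hsp : SDStrategyproof f) :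
    f (rankProfile P6) 0 = 0 ∧ f (rankProfile P6) 1 = 0 ∧
      f (rankProfile P6) 2 = 1/2 ∧ f (rankProfile P6) 3 = 1/2 := by
  obtain ⟨-, h1, h2, h3, hs⟩ := lottery_rankProfile hf P6
  obtain ⟨a5, b5, c5, d5⟩ := apply_P5 hf han hneu heff hsp
  have a6 := eq_zero_of_dominated hf heff P6 0 1 (by decide) 1 (by decide)
  have hcd : f (rankProfile P6) 3 = f (rankProfile P6) 2 := apply_relabel han hneu
    (rk := P6) (rk' := P6) (Equiv.swap 2 3) (Equiv.swap 2 3) (by decide) 2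
  have h := hsp.reverse P5 P6 2 ![2,0,1,0] rfl (by decide)
  simp [Fin.forall_fin_succ, Fin.sum_univ_four, a5, b5, c5, d5, a6, hcd] at h hs
  obtain ⟨-, h', -⟩ := h (by linarith) (by linarith) (by linarith) (by linarith)
  refine ⟨a6, ?_, ?_, ?_⟩ <;> linarith

/-- No anonymous, neutral, sd-efficient and sd-strategyproof scheme exists. -/
theorem false_of_axioms (hf : IsSDS f) (han : Anonymous f) (hneu : Neutral f)
    (heff : SDEfficient f) (hsp : SDStrategyproof f) : False := by
  obtain ⟨-, p1, p2, p3, ps⟩ := lottery_rankProfile hf P1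
  obtain ⟨-, h1, h2, h3, hs⟩ := lottery_rankProfile hf P2
  obtain ⟨a6, b6, c6, d6⟩ := apply_P6 hf han hneu heff hsp
  have a1 := eq_zero_of_dominated hf heff P1 0 1 (by decide) 1 (by decide)
  have c1 := eq_zero_of_dominated hf heff P1 2 3 (by decide) 2 (by decide)
  have a2 := eq_zero_of_dominated hf heff P2 0 1 (by decide) 1 (by decide)
  have c2 := eq_zero_of_dominated hf heff P2 2 3 (by decide) 2 (by decide)
  have hbd : f (rankProfile P2) 3 = f (rankProfile P2) 1 := apply_relabel han hneu
    (rk := P2) (rk' := P2) (Equiv.swap 0 3 * Equiv.swap 1 2)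
    (Equiv.swap 0 2 * Equiv.swap 1 3) (by decide) 1
  have h61 := hsp.reverse P6 P1 3 ![2,0,1,2] rfl (by decide)
  have h21 := hsp.reverse P2 P1 1 ![2,1,2,0] rfl (by decide)
  simp [Fin.forall_fin_succ, Fin.sum_univ_four, a6, b6, c6, d6, a1, c1, a2, c2, hbd] at h61 h21 hs ps
  have hlt : f (rankProfile P1) 1 < 2⁻¹ := by
    by_contra! hge
    obtain ⟨-, h', -⟩ := h61 (by linarith) p1 hge (by linarith)
    linarith
  obtain ⟨-, h'⟩ := h21 (by linarith) (by linarith)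
  linarith

end Axioms

theorem stmt11 (f : (Fin 4 → Fin 4 → Fin 4 → Prop) → (Fin 4 → ℝ))
    (hf : IsSDS f) (han : Anonymous f) (hneu : Neutral f)
    (heff : SDEfficient f) (hsp : SDStrategyproof f) :
    f R8 = ![1/2, 1/2, 0, 0] := by
  exact (false_of_axioms hf han hneu heff hsp).elim
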